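/- arXiv:2210.14520 — 4 statements merged into one kernel-verified Lean document; each statement's English description precedes it below -/
import Mathlib

section
/- Let E be a real Hilbert space, J : E → ℝ twice continuously differentiable, Θ ∈ E, Θ̇ ∈ E with Θ̇ ≠ 0, L > 0 and 0 < ℓ < 1. Set r = ⟨Θ̇, ∇J(Θ)⟩ / (‖Θ̇‖² L). If ⟨Θ̇, ∇J(Θ)⟩ > 0 and |⟨∇²J(Θ − tΘ̇)Θ̇, Θ̇⟩| ≤ L·‖Θ̇‖² for all t ∈ [0, ℓr], then J(Θ − ℓ r Θ̇) < J(Θ). -/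
open scoped RealInnerProductSpace

/-- For a direction of descent (`⟨Θ̇, ∇J(Θ)⟩ > 0`), a learning rate `0 < ℓ < 1`
and the rescaling `r = ⟨Θ̇, ∇J(Θ)⟩ / (‖Θ̇‖² L)`, under the curvature bound on
`[0, ℓr]` the rescaled update strictly decreases `J`. -/
theorem rescaled_step_strict_decrease
    {E : Type*} [NormedAddCommGroup E] [InnerProductSpace ℝ E] [CompleteSpace E]
    (J : E → ℝ) (hJ : ContDiff ℝ 2 J) (Θ Θd : E) (hΘd : Θd ≠ 0)
    (L : ℝ) (hL : 0 < L) (ℓ : ℝ) (hℓ0 : 0 < ℓ) (hℓ1 : ℓ < 1)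
    (r : ℝ) (hr : r = ⟪Θd, gradient J Θ⟫ / (‖Θd‖ ^ 2 * L))
    (hdescent : 0 < ⟪Θd, gradient J Θ⟫)
    (hcurv : ∀ t ∈ Set.Icc (0:ℝ) (ℓ * r),
      |iteratedFDeriv ℝ 2 J (Θ - t • Θd) ![Θd, Θd]| ≤ L * ‖Θd‖ ^ 2) :
    J (Θ - (ℓ * r) • Θd) < J Θ := by
  have hJ1 : Differentiable ℝ J := hJ.differentiable (by norm_num)
  have hJ2 : Differentiable ℝ (fderiv ℝ J) :=
    (hJ.fderiv_right (m := 1) (by norm_num)).differentiable (by norm_num)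
  have hd : 0 < ‖Θd‖ := norm_pos_iff.mpr hΘd
  have hM : 0 < L * ‖Θd‖ ^ 2 := by positivity
  have hr0 : 0 < r := by rw [hr]; positivity
  have hlr : 0 < ℓ * r := by positivity
  have hgrad : ⟪Θd, gradient J Θ⟫ = fderiv ℝ J Θ Θd := by
    rw [real_inner_comm, gradient, InnerProductSpace.toDual_symm_apply]
  have ha : fderiv ℝ J Θ Θd = L * ‖Θd‖ ^ 2 * r := by
    rw [hr, hgrad]; field_simp
  have hline : ∀ t : ℝ, HasDerivAt (fun t : ℝ => Θ - t • Θd) (-Θd) t := by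
    intro t
    simpa using ((hasDerivAt_id t).smul_const Θd).const_sub Θ
  have hg1 : ∀ t : ℝ, HasDerivAt (fun t : ℝ => J (Θ - t • Θd))
      (-(fderiv ℝ J (Θ - t • Θd) Θd)) t := by
    intro t
    have := (hJ1 (Θ - t • Θd)).hasFDerivAt.comp_hasDerivAt t (hline t)
    rw [map_neg] at this
    exact this
  have hg2 : ∀ t : ℝ, HasDerivAt
      (fun t : ℝ => -(fderiv ℝ J (Θ - t • Θd) Θd) - L * ‖Θd‖ ^ 2 * t)
      (iteratedFDeriv ℝ 2 J (Θ - t • Θd) ![Θd, Θd] - L * ‖Θd‖ ^ 2) t := by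
    intro t
    have h1 := (hJ2 (Θ - t • Θd)).hasFDerivAt.comp_hasDerivAt t (hline t)
    have h2 := (h1.clm_apply (hasDerivAt_const t Θd)).neg.sub
      ((hasDerivAt_id t).const_mul (L * ‖Θd‖ ^ 2))
    rw [iteratedFDeriv_two_apply]
    simp at h2
    simp only [Matrix.cons_val_zero, Matrix.cons_val_one]
    exact h2
  have hanti : AntitoneOn (fun t : ℝ => -(fderiv ℝ J (Θ - t • Θd) Θd) - L * ‖Θd‖ ^ 2 * t)
      (Set.Icc 0 (ℓ * r)) := by
    refine antitoneOn_of_deriv_nonpos (convex_Icc _ _)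
      (fun t _ => (hg2 t).continuousAt.continuousWithinAt)
      (fun t _ => (hg2 t).differentiableAt.differentiableWithinAt) ?_
    intro t ht
    rw [(hg2 t).deriv]
    linarith [(abs_le.mp (hcurv t (interior_subset ht))).2]
  have hs : StrictAntiOn (fun t : ℝ => J (Θ - t • Θd)) (Set.Icc 0 (ℓ * r)) := by
    refine strictAntiOn_of_deriv_neg (convex_Icc _ _)
      (fun t _ => (hg1 t).continuousAt.continuousWithinAt) ?_
    intro t ht
    rw [(hg1 t).deriv]
    have ht' := interior_subset ht
    have h := hanti (Set.left_mem_Icc.mpr hlr.le) ht' ht'.1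
    simp only [zero_smul, sub_zero, mul_zero, ha] at h
    have : t < r := lt_of_le_of_lt ht'.2 (by nlinarith)
    nlinarith [mul_lt_mul_of_pos_left this hM]
  simpa using hs (Set.left_mem_Icc.mpr hlr.le) (Set.right_mem_Icc.mpr hlr.le) hlr
end

section
/- Let H₀,…,H_{n+1} and G₀,…,G_n be real Hilbert spaces with H_{n+1} = ℝ. For 0 ≤ s ≤ n let F_s : H_s × G_s → H_{s+1} be twice continuously differentiable. Fix x₀ ∈ H₀ and for Θ = (θ₀,…,θ_n) define x_{s+1}(Θ) = F_s(x_s(Θ), θ_s) and J(Θ) = x_{n+1}(Θ). Let Θ̇ = (θ̇_s)_s be a direction, ẋ_s the tangent (ẋ₀ = 0, ẋ_{s+1} = (∂_xF_s)ẋ_s + (∂_θF_s)θ̇_s) and x̂_s the backward pass (x̂_{n+1} = 1, x̂_s = (∂_xF_s)* x̂_{s+1}). Then the second directional derivative of J satisfies ⟨∇²J(Θ)Θ̇, Θ̇⟩ = Σ_{s=0}^n ⟨x̂_{s+1}, ∇²F_s((ẋ_s, θ̇_s), (ẋ_s, θ̇_s))⟩, where ∇²F_s is the second derivative of F_s at (x_s(Θ),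 θ_s). -/
open scoped RealInnerProductSpace

theorem fderiv2_comp_aux {E A B : Type*} [NormedAddCommGroup E] [NormedSpace ℝ E]
    [NormedAddCommGroup A] [NormedSpace ℝ A] [NormedAddCommGroup B] [NormedSpace ℝ B]
    {f : A → B} {g : E → A} (hf : ContDiff ℝ 2 f) (hg : ContDiff ℝ 2 g) (z v w : E) :
    fderiv ℝ (fderiv ℝ (fun y => f (g y))) z v w
      = fderiv ℝ (fderiv ℝ f) (g z) (fderiv ℝ g z v) (fderiv ℝ g z w)
        + fderiv ℝ f (g z) (fderiv ℝ (fderiv ℝ g) z v w) := by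
  have hf1 : Differentiable ℝ f := hf.differentiable (by norm_num)
  have hg1 : Differentiable ℝ g := hg.differentiable (by norm_num)
  have hf2 : Differentiable ℝ (fderiv ℝ f) :=
    (hf.fderiv_right (m := 1) (by norm_num)).differentiable (by norm_num)
  have hg2 : Differentiable ℝ (fderiv ℝ g) :=
    (hg.fderiv_right (m := 1) (by norm_num)).differentiable (by norm_num)
  have h1 : fderiv ℝ (fun y => f (g y)) = fun y => (fderiv ℝ f (g y)).comp (fderiv ℝ g y) := by
    funext y
    exact fderiv_comp y (hf1 _) (hg1 _)
  have h2 : HasFDerivAt (fun y => fderiv ℝ f (g y))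
      ((fderiv ℝ (fderiv ℝ f) (g z)).comp (fderiv ℝ g z)) z :=
    (hf2 (g z)).hasFDerivAt.comp z (hg1 z).hasFDerivAt
  have h3 := h2.clm_comp (hg2 z).hasFDerivAt
  rw [h1, h3.fderiv]
  simp [add_comm]

theorem fderiv_prod_aux {E A B : Type*} [NormedAddCommGroup E] [NormedSpace ℝ E]
    [NormedAddCommGroup A] [NormedSpace ℝ A] [NormedAddCommGroup B] [NormedSpace ℝ B]
    {g : E → A} (hg : ContDiff ℝ 2 g) (L : E →L[ℝ] B) (z v w : E) :
    fderiv ℝ (fun y => (g y, L y)) z v = (fderiv ℝ g z v, L v) ∧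
    fderiv ℝ (fderiv ℝ (fun y => (g y, L y))) z v w = (fderiv ℝ (fderiv ℝ g) z v w, 0) := by
  have hg1 : Differentiable ℝ g := hg.differentiable (by norm_num)
  have hp : ContDiff ℝ 2 (fun y => (g y, L y)) := hg.prodMk L.contDiff
  have h1 : ∀ y, fderiv ℝ (fun y => (g y, L y)) y = (fderiv ℝ g y).prod L := fun y =>
    ((hg1 y).hasFDerivAt.prodMk L.hasFDerivAt).fderiv
  refine ⟨by rw [h1]; rfl, ?_⟩
  have ha := fderiv2_comp_aux (f := Prod.fst) (contDiff_fst) hp z v w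
  have hb := fderiv2_comp_aux (f := Prod.snd) (contDiff_snd) hp z v w
  have e1 : fderiv ℝ (Prod.fst : A × B → A) = fun _ => ContinuousLinearMap.fst ℝ A B := by
    funext y; exact fderiv_fst
  have e2 : fderiv ℝ (Prod.snd : A × B → B) = fun _ => ContinuousLinearMap.snd ℝ A B := by
    funext y; exact fderiv_snd
  have e3 : fderiv ℝ (fun y => L y) = fun _ => L := by
    funext y; exact L.fderiv
  simp [e1] at ha
  simp [e2, e3] at hb
  exact Prod.ext ha.symm hb.symm

theorem fderiv_split_aux {A B C : Type*}
    [NormedAddCommGroup A] [NormedSpace ℝ A] [NormedAddCommGroup B] [NormedSpace ℝ B]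
    [NormedAddCommGroup C] [NormedSpace ℝ C]
    {f : A × B → C} (hf : ContDiff ℝ 2 f) (a : A) (b : B) :
    (∀ v, fderiv ℝ (fun y => f (y, b)) a v = fderiv ℝ f (a, b) (v, 0)) ∧
    (∀ w, fderiv ℝ (fun y => f (a, y)) b w = fderiv ℝ f (a, b) (0, w)) := by
  have hf1 : HasFDerivAt f _ (a, b) := (hf.differentiable (by norm_num) (a, b)).hasFDerivAt
  constructor
  · intro v
    have := hf1.comp a (hasFDerivAt_prodMk_left (𝕜 := ℝ) a b)
    have h := this.fderiv
    simp only [Function.comp_def] at h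
    rw [h]; simp
  · intro v
    have := hf1.comp b (hasFDerivAt_prodMk_right (𝕜 := ℝ) a b)
    have h := this.fderiv
    simp only [Function.comp_def] at h
    rw [h]; simp

/-- Curvature computation (Algorithm 2): for a feed-forward network with `C²`
layers and scalar output `J(Θ) = x_{n+1}(Θ)` (identification `H_{n+1} = ℝ`
given by the linear isometry `e`), with tangent pass `ẋ` and backward pass `x̂`,
the second directional derivative of `J` satisfies
`⟨∇²J(Θ)Θ̇, Θ̇⟩ = ∑_s ⟨x̂_{s+1}, ∇²F_s((ẋ_s,θ̇_s),(ẋ_s,θ̇_s))⟩`. -/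
theorem curvature_backprop_formula
    {n : ℕ} (H : ℕ → Type*) (G : ℕ → Type*)
    [∀ s, NormedAddCommGroup (H s)] [∀ s, InnerProductSpace ℝ (H s)]
    [∀ s, CompleteSpace (H s)]
    [∀ s, NormedAddCommGroup (G s)] [∀ s, InnerProductSpace ℝ (G s)]
    [∀ s, CompleteSpace (G s)]
    (e : H (n + 1) ≃ₗᵢ[ℝ] ℝ)
    (F : ∀ s : Fin (n + 1), H s × G s → H (s + 1))
    (hF : ∀ s : Fin (n + 1), ContDiff ℝ 2 (F s))
    (x₀ : H 0)
    (x : PiLp 2 (fun s : Fin (n + 1) => G s) → ∀ s : ℕ, H s)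
    (hx0 : ∀ Θ, x Θ 0 = x₀)
    (hxrec : ∀ Θ, ∀ s : Fin (n + 1), x Θ (s + 1) = F s (x Θ s, Θ s))
    (J : PiLp 2 (fun s : Fin (n + 1) => G s) → ℝ)
    (hJ : ∀ Θ, J Θ = e (x Θ (n + 1)))
    (Θ Θd : PiLp 2 (fun s : Fin (n + 1) => G s))
    (xd : ∀ s : ℕ, H s)
    (hxd0 : xd 0 = 0)
    (hxd : ∀ s : Fin (n + 1),
      xd (s + 1) = fderiv ℝ (fun y => F s (y, Θ s)) (x Θ s) (xd s)
        + fderiv ℝ (fun θ' => F s (x Θ s, θ')) (Θ s) (Θd s))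
    (xhat : ∀ s : ℕ, H s)
    (hxhatTop : xhat (n + 1) = e.symm 1)
    (hxhat : ∀ s : Fin (n + 1),
      xhat s = ContinuousLinearMap.adjoint
        (fderiv ℝ (fun y => F s (y, Θ s)) (x Θ s)) (xhat (s + 1))) :
    iteratedFDeriv ℝ 2 J Θ ![Θd, Θd]
      = ∑ s : Fin (n + 1),
          ⟪xhat (s + 1),
            iteratedFDeriv ℝ 2 (F s) (x Θ s, Θ s) ![(xd s, Θd s), (xd s, Θd s)]⟫ := by
  have hstep : ∀ s : Fin (n + 1), (fun T => x T (s + 1)) =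
      fun T => F s (x T s, PiLp.proj (𝕜 := ℝ) 2 (fun s : Fin (n + 1) => G s) s T) := by
    intro s; funext T; exact hxrec T s
  have hC : ∀ k : ℕ, k ≤ n + 1 → ContDiff ℝ 2 (fun T => x T k) := by
    intro k
    induction k with
    | zero => intro _; simp only [hx0]; exact contDiff_const
    | succ k ih =>
      intro hk
      have h := hstep ⟨k, by omega⟩
      simp only at h
      rw [h]
      exact (hF ⟨k, by omega⟩).comp ((ih (by omega)).prodMk (ContinuousLinearMap.contDiff _))
  have hD : ∀ k : ℕ, k ≤ n + 1 → fderiv ℝ (fun T => x T k) Θ Θd = xd k := by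
    intro k
    induction k with
    | zero => intro _; simp [hx0, hxd0]
    | succ k ih =>
      intro hk
      have h := hstep ⟨k, by omega⟩
      have h' := hxd ⟨k, by omega⟩
      have hk' := hC k (by omega)
      have hFk := hF ⟨k, by omega⟩
      simp only at h h' hFk
      rw [h, h', (fderiv_split_aux hFk _ _).1, (fderiv_split_aux hFk _ _).2, ← map_add]
      have hp := (fderiv_prod_aux hk' (PiLp.proj (𝕜 := ℝ) 2 (fun s : Fin (n + 1) => G s)
        ⟨k, by omega⟩) Θ Θd Θd).1
      have hc := fderiv_comp Θ (g := F ⟨k, by omega⟩)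
        (f := fun T => (x T k, PiLp.proj (𝕜 := ℝ) 2 (fun s : Fin (n + 1) => G s)
          ⟨k, by omega⟩ T)) (hFk.differentiable (by norm_num) _)
        ((hk'.prodMk (ContinuousLinearMap.contDiff _)).differentiable (by norm_num) _)
      simp only [Function.comp_def] at hc
      rw [hc, ContinuousLinearMap.comp_apply, hp, ih (by omega)]
      simp
  let u : ℕ → ℝ := fun k => ⟪xhat k, fderiv ℝ (fderiv ℝ (fun T => x T k)) Θ Θd Θd⟫
  have hterm : ∀ s : Fin (n + 1),
      ⟪xhat (s + 1),
        iteratedFDeriv ℝ 2 (F s) (x Θ s, Θ s) ![(xd s, Θd s), (xd s, Θd s)]⟫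
        = u (s + 1) - u s := by
    intro s
    have hk' := hC s (by omega)
    have hp := fderiv_prod_aux hk' (PiLp.proj (𝕜 := ℝ) 2 (fun s : Fin (n + 1) => G s) s) Θ Θd Θd
    have hc := fderiv2_comp_aux (hF s) (hk'.prodMk (ContinuousLinearMap.contDiff
      (PiLp.proj (𝕜 := ℝ) 2 (fun s : Fin (n + 1) => G s) s))) Θ Θd Θd
    rw [hp.1, hp.2, hD s (by omega)] at hc
    simp only [u]
    rw [hstep s, hc, hxhat s, ContinuousLinearMap.adjoint_inner_left,
      (fderiv_split_aux (hF s) _ _).1, inner_add_right, iteratedFDeriv_two_apply]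
    simp
  rw [Finset.sum_congr rfl (fun s _ => hterm s)]
  rw [← Finset.sum_range (fun k => u (k + 1) - u k), Finset.sum_range_sub]
  have hu0 : u 0 = 0 := by
    simp [u, hx0]
  have hJ' : J = fun T => (e.toContinuousLinearEquiv : H (n + 1) →L[ℝ] ℝ) (x T (n + 1)) := by
    funext T; exact hJ T
  rw [hu0, sub_zero, iteratedFDeriv_two_apply, hJ']
  have hc := fderiv2_comp_aux (f := fun y => (e.toContinuousLinearEquiv : H (n + 1) →L[ℝ] ℝ) y)
    (ContinuousLinearMap.contDiff _) (hC (n + 1) le_rfl) Θ Θd Θd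
  have e3 : fderiv ℝ (fun y => (e.toContinuousLinearEquiv : H (n + 1) →L[ℝ] ℝ) y)
      = fun _ => (e.toContinuousLinearEquiv : H (n + 1) →L[ℝ] ℝ) := by
    funext y; exact ContinuousLinearMap.fderiv _
  rw [e3] at hc
  simp only [Matrix.cons_val_zero, Matrix.cons_val_one]
  rw [hc]
  simp only [u]
  rw [hxhatTop, ← e.inner_map_map]
  simp
end

section
/- Let H₀,…,H_{n+1} and G₀,…,G_n be real Hilbert spaces with H_{n+1} = ℝ. For 0 ≤ s ≤ n let F_s : H_s × G_s → H_{s+1} be twice continuously differentiable. Fix x₀ ∈ H₀ and for Θ = (θ₀,…,θ_n) define x_{s+1}(Θ) = F_s(x_s(Θ), θ_s) and J(Θ) = x_{n+1}(Θ). Let Θ̇ and Θ̇' be two directions with tangents ẋ_s and ẋ'_s (ẋ₀ = ẋ'₀ = 0, ẋ_{s+1} = (∂_xF_s)ẋ_s + (∂_θF_s)θ̇_s and similarly for ẋ'), and let x̂_s be the backward pass (x̂_{n+1} = 1, x̂_s = (∂_xF_s)* x̂_{s+1}). Then the bilinear second derivative of J satisfies ⟨∇²J(Θ)Θ̇, Θ̇'⟩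 = Σ_{s=0}^n ⟨x̂_{s+1}, ∇²F_s((ẋ_s, θ̇_s), (ẋ'_s, θ̇'_s))⟩. -/
open scoped RealInnerProductSpace

theorem aux_second_comp {E P Y : Type*} [NormedAddCommGroup E] [NormedSpace ℝ E]
    [NormedAddCommGroup P] [NormedSpace ℝ P] [NormedAddCommGroup Y] [NormedSpace ℝ Y]
    {p : E → P} {f : P → Y} (hp : ContDiff ℝ 2 p) (hf : ContDiff ℝ 2 f) (a u v : E) :
    fderiv ℝ (fderiv ℝ (fun z => f (p z))) a u v
      = fderiv ℝ (fderiv ℝ f) (p a) (fderiv ℝ p a u) (fderiv ℝ p a v)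
        + fderiv ℝ f (p a) (fderiv ℝ (fderiv ℝ p) a u v) := by
  have hpd : Differentiable ℝ p := hp.differentiable (by norm_num)
  have hfd : Differentiable ℝ f := hf.differentiable (by norm_num)
  have hpd2 : Differentiable ℝ (fderiv ℝ p) :=
    (hp.fderiv_right (m := 1) (by norm_num)).differentiable (by norm_num)
  have hfd2 : Differentiable ℝ (fderiv ℝ f) :=
    (hf.fderiv_right (m := 1) (by norm_num)).differentiable (by norm_num)
  have h1 : fderiv ℝ (fun z => f (p z)) = fun z => (fderiv ℝ f (p z)).comp (fderiv ℝ p z) := by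
    funext z
    exact ((hfd (p z)).hasFDerivAt.comp z (hpd z).hasFDerivAt).fderiv
  have h2 : HasFDerivAt (fun z => fderiv ℝ f (p z))
      ((fderiv ℝ (fderiv ℝ f) (p a)).comp (fderiv ℝ p a)) a :=
    (hfd2 (p a)).hasFDerivAt.comp a (hpd a).hasFDerivAt
  rw [h1, (h2.clm_comp (hpd2 a).hasFDerivAt).fderiv]
  simp [add_comm]

theorem aux_second_prod {E X Y : Type*} [NormedAddCommGroup E] [NormedSpace ℝ E]
    [NormedAddCommGroup X] [NormedSpace ℝ X] [NormedAddCommGroup Y] [NormedSpace ℝ Y]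
    {f : E → X} (L : E →L[ℝ] Y) (hf : ContDiff ℝ 2 f) (a u v : E) :
    fderiv ℝ (fun z => (f z, L z)) a u = (fderiv ℝ f a u, L u) ∧
    fderiv ℝ (fderiv ℝ (fun z => (f z, L z))) a u v = (fderiv ℝ (fderiv ℝ f) a u v, 0) := by
  have hfd : Differentiable ℝ f := hf.differentiable (by norm_num)
  have hfd2 : Differentiable ℝ (fderiv ℝ f) :=
    (hf.fderiv_right (m := 1) (by norm_num)).differentiable (by norm_num)
  have h1 : fderiv ℝ (fun z => (f z, L z)) = fun z => (fderiv ℝ f z).prod L := by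
    funext z
    exact ((hfd z).hasFDerivAt.prodMk L.hasFDerivAt).fderiv
  refine ⟨by rw [h1]; rfl, ?_⟩
  have hp : ContDiff ℝ 2 (fun z => (f z, L z)) := hf.prodMk L.contDiff
  have hpd2 : Differentiable ℝ (fderiv ℝ (fun z => (f z, L z))) :=
    (hp.fderiv_right (m := 1) (by norm_num)).differentiable (by norm_num)
  have h3 : fderiv ℝ (fun z => fderiv ℝ (fun z => (f z, L z)) z v) a u
      = fderiv ℝ (fderiv ℝ (fun z => (f z, L z))) a u v := by
    rw [((hpd2 a).hasFDerivAt.clm_apply (hasFDerivAt_const v a)).fderiv]; simp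
  have h4 : HasFDerivAt (fun z => fderiv ℝ f z v) ((fderiv ℝ (fderiv ℝ f) a).flip v) a := by
    have := (hfd2 a).hasFDerivAt.clm_apply (hasFDerivAt_const v a)
    simpa using this
  rw [← h3, h1]
  have h5 : HasFDerivAt (fun z => ((fderiv ℝ f z).prod L) v)
      (((fderiv ℝ (fderiv ℝ f) a).flip v).prod 0) a :=
    h4.prodMk (hasFDerivAt_const (L v) a)
  rw [h5.fderiv]; simp

theorem aux_partial {X Y Z : Type*} [NormedAddCommGroup X] [NormedSpace ℝ X]
    [NormedAddCommGroup Y] [NormedSpace ℝ Y] [NormedAddCommGroup Z] [NormedSpace ℝ Z]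
    {f : X × Y → Z} (hf : Differentiable ℝ f) (a : X) (b : Y) (u : X) (v : Y) :
    fderiv ℝ f (a, b) (u, v) = fderiv ℝ (fun y => f (y, b)) a u
      + fderiv ℝ (fun t => f (a, t)) b v := by
  have h1 : HasFDerivAt (fun y => f (y, b)) _ a :=
    (hf (a, b)).hasFDerivAt.comp a (hasFDerivAt_prodMk_left a b)
  have h2 : HasFDerivAt (fun t => f (a, t)) _ b :=
    (hf (a, b)).hasFDerivAt.comp b (hasFDerivAt_prodMk_right a b)
  rw [h1.fderiv, h2.fderiv]
  simp [← map_add]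

/-- Polarized curvature computation: for a feed-forward network with `C²`
layers and scalar output `J(Θ) = x_{n+1}(Θ)` (identification `H_{n+1} = ℝ`
given by the linear isometry `e`), with tangent passes `ẋ`, `ẋ'` in the
directions `Θ̇`, `Θ̇'` and backward pass `x̂`, the bilinear second derivative
of `J` satisfies `⟨∇²J(Θ)Θ̇, Θ̇'⟩ = ∑_s ⟨x̂_{s+1}, ∇²F_s((ẋ_s,θ̇_s),(ẋ'_s,θ̇'_s))⟩`. -/
theorem curvature_backprop_formula_bilinear
    {n : ℕ} (H : ℕ → Type*) (G : ℕ → Type*)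
    [∀ s, NormedAddCommGroup (H s)] [∀ s, InnerProductSpace ℝ (H s)]
    [∀ s, CompleteSpace (H s)]
    [∀ s, NormedAddCommGroup (G s)] [∀ s, InnerProductSpace ℝ (G s)]
    [∀ s, CompleteSpace (G s)]
    (e : H (n + 1) ≃ₗᵢ[ℝ] ℝ)
    (F : ∀ s : Fin (n + 1), H s × G s → H (s + 1))
    (hF : ∀ s : Fin (n + 1), ContDiff ℝ 2 (F s))
    (x₀ : H 0)
    (x : PiLp 2 (fun s : Fin (n + 1) => G s) → ∀ s : ℕ, H s)
    (hx0 : ∀ Θ, x Θ 0 = x₀)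
    (hxrec : ∀ Θ, ∀ s : Fin (n + 1), x Θ (s + 1) = F s (x Θ s, Θ s))
    (J : PiLp 2 (fun s : Fin (n + 1) => G s) → ℝ)
    (hJ : ∀ Θ, J Θ = e (x Θ (n + 1)))
    (Θ Θd Θd' : PiLp 2 (fun s : Fin (n + 1) => G s))
    (xd xd' : ∀ s : ℕ, H s)
    (hxd0 : xd 0 = 0)
    (hxd : ∀ s : Fin (n + 1),
      xd (s + 1) = fderiv ℝ (fun y => F s (y, Θ s)) (x Θ s) (xd s)
        + fderiv ℝ (fun θ' => F s (x Θ s, θ')) (Θ s) (Θd s))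
    (hxd'0 : xd' 0 = 0)
    (hxd' : ∀ s : Fin (n + 1),
      xd' (s + 1) = fderiv ℝ (fun y => F s (y, Θ s)) (x Θ s) (xd' s)
        + fderiv ℝ (fun θ' => F s (x Θ s, θ')) (Θ s) (Θd' s))
    (xhat : ∀ s : ℕ, H s)
    (hxhatTop : xhat (n + 1) = e.symm 1)
    (hxhat : ∀ s : Fin (n + 1),
      xhat s = ContinuousLinearMap.adjoint
        (fderiv ℝ (fun y => F s (y, Θ s)) (x Θ s)) (xhat (s + 1))) :
    iteratedFDeriv ℝ 2 J Θ ![Θd, Θd']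
      = ∑ s : Fin (n + 1),
          ⟪xhat (s + 1),
            iteratedFDeriv ℝ 2 (F s) (x Θ s, Θ s) ![(xd s, Θd s), (xd' s, Θd' s)]⟫ := by
  let E := PiLp 2 (fun s : Fin (n + 1) => G s)
  let L : ∀ s : Fin (n + 1), E →L[ℝ] G s := fun s => PiLp.proj 2 (fun s : Fin (n + 1) => G s) s
  have hfun : ∀ s : Fin (n + 1),
      (fun T : E => x T (s + 1)) = fun T : E => F s (x T s, L s T) := by
    intro s; funext T; exact hxrec T s
  have hC : ∀ k : ℕ, k ≤ n + 1 → ContDiff ℝ 2 (fun T : E => x T k) := by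
    intro k
    induction k with
    | zero =>
      intro _
      have : (fun T : E => x T 0) = fun _ => x₀ := funext hx0
      rw [this]; exact contDiff_const
    | succ k ih =>
      intro hk
      have h := hfun ⟨k, hk⟩
      simp only at h
      rw [h]
      exact (hF ⟨k, hk⟩).comp ((ih (by omega)).prodMk (L ⟨k, hk⟩).contDiff)
  have hFd : ∀ s, Differentiable ℝ (F s) := fun s => (hF s).differentiable (by norm_num)
  have hT : ∀ (Td : E) (yd : ∀ s : ℕ, H s), yd 0 = 0 →
      (∀ s : Fin (n + 1),
        yd (s + 1) = fderiv ℝ (fun y => F s (y, Θ s)) (x Θ s) (yd s)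
        + fderiv ℝ (fun θ' => F s (x Θ s, θ')) (Θ s) (Td s)) →
      ∀ k : ℕ, k ≤ n + 1 → fderiv ℝ (fun T : E => x T k) Θ Td = yd k := by
    intro Td yd h0 hs k
    induction k with
    | zero =>
      intro _
      have : (fun T : E => x T 0) = fun _ => x₀ := funext hx0
      rw [this, h0]; simp
    | succ k ih =>
      intro hk
      have hs' := hs ⟨k, hk⟩
      have h := hfun ⟨k, hk⟩
      have hCk := hC k (by omega)
      simp only at h hs'
      rw [h, hs', ← aux_partial (hFd ⟨k, hk⟩), ← ih (by omega)]
      have hp := (aux_second_prod (L ⟨k, hk⟩) hCk Θ Td Td).1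
      have hpd : Differentiable ℝ (fun T : E => (x T k, L ⟨k, hk⟩ T)) :=
        (hCk.prodMk (L ⟨k, hk⟩).contDiff).differentiable (by norm_num)
      have hc : HasFDerivAt (fun T : E => F ⟨k, hk⟩ (x T k, L ⟨k, hk⟩ T)) _ Θ :=
        (hFd ⟨k, hk⟩ (x Θ k, L ⟨k, hk⟩ Θ)).hasFDerivAt.comp Θ (hpd Θ).hasFDerivAt
      rw [hc.fderiv, ContinuousLinearMap.comp_apply, hp]
      rfl
  let a : ℕ → ℝ := fun k => ⟪xhat k, fderiv ℝ (fderiv ℝ (fun T : E => x T k)) Θ Θd Θd'⟫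
  have hstep : ∀ s : Fin (n + 1), ⟪xhat (s + 1),
      iteratedFDeriv ℝ 2 (F s) (x Θ s, Θ s) ![(xd s, Θd s), (xd' s, Θd' s)]⟫
        = a (s + 1) - a s := by
    intro s
    have hs1 : (s : ℕ) ≤ n + 1 := s.2.le
    have hCk := hC s hs1
    have e1 := aux_second_prod (L s) hCk Θ Θd Θd'
    have e2 := aux_second_prod (L s) hCk Θ Θd' Θd
    have e3 := aux_second_comp (hCk.prodMk (L s).contDiff) (hF s) Θ Θd Θd'
    simp only [a]
    rw [hfun s, e3, e1.1, e1.2, e2.1, hT Θd xd hxd0 hxd s hs1, hT Θd' xd' hxd'0 hxd' s hs1,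
      inner_add_right, hxhat s, ContinuousLinearMap.adjoint_inner_left,
      iteratedFDeriv_two_apply]
    have e4 := aux_partial (hFd s) (x Θ s) (Θ s)
      (fderiv ℝ (fderiv ℝ (fun T : E => x T s)) Θ Θd Θd') 0
    rw [map_zero, add_zero] at e4
    rw [← e4]
    exact (add_sub_cancel_right _ _).symm
  rw [Finset.sum_congr rfl (fun s _ => hstep s),
    Fin.sum_univ_eq_sum_range (fun k => a (k + 1) - a k) (n + 1), Finset.sum_range_sub]
  have ha0 : a 0 = 0 := by
    have : (fun T : E => x T 0) = fun _ => x₀ := funext hx0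
    simp only [a]
    rw [this]; simp
  have hJ' : J = fun T : E => (e.toContinuousLinearEquiv : H (n + 1) →L[ℝ] ℝ) (x T (n + 1)) :=
    funext hJ
  have hCn := hC (n + 1) le_rfl
  let eL : H (n + 1) →L[ℝ] ℝ := (e.toContinuousLinearEquiv : H (n + 1) →L[ℝ] ℝ)
  have e5 := aux_second_comp hCn eL.contDiff Θ Θd Θd'
  have e6 : fderiv ℝ (eL : H (n + 1) → ℝ) = fun _ => eL := by
    funext z; exact eL.fderiv
  rw [e6] at e5
  rw [ha0, sub_zero, iteratedFDeriv_two_apply, hJ']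
  refine e5.trans ?_
  simp only [a]
  rw [hxhatTop]
  have e7 : ∀ w : H (n + 1), ⟪e.symm 1, w⟫ = e w := by
    intro w
    rw [← e.inner_map_map]; simp
  rw [e7]
  simp [eL]
end

section
/- Let H₀,…,H_{n+1} and G₀,…,G_n be real Hilbert spaces with H_{n+1} = ℝ. For 0 ≤ s ≤ n let F_s : H_s × G_s → H_{s+1} be twice continuously differentiable. Fix x₀ ∈ H₀ and for Θ = (θ₀,…,θ_n) define x_{s+1}(Θ) = F_s(x_s(Θ), θ_s) and J(Θ) = x_{n+1}(Θ). Fix a direction Θ̇ = (θ̇_s)_s with tangent ẋ_s and backward pass x̂_s as above. For each s, let (A_s, B_s) ∈ H_s × G_s be the Riesz representatives characterized by ⟨A_s, a⟩ + ⟨B_s, b⟩ = ⟨∇²F_s((ẋ_s, θ̇_s), (a, b)), x̂_{s+1}⟩ for all (a,b) ∈ H_s × G_s, and define the backward recurrence x̃_{n+1} = 0, x̃_s = (∂_xF_s)* x̃_{s+1} + A_s, θ̃_s = (∂_θF_s)* x̃_{s+1} + B_s. Then the Hessian-vector product satisfies ∇²J(Θ)Θ̇ = (θ̃₀,…,θ̃_n),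 i.e. ⟨∇²J(Θ)Θ̇, Θ̇'⟩ = Σ_s ⟨θ̃_s, θ̇'_s⟩ for every direction Θ̇'. -/
open scoped RealInnerProductSpace

section Helpers
variable {E H G K : Type*} [NormedAddCommGroup E] [NormedSpace ℝ E]
  [NormedAddCommGroup H] [NormedSpace ℝ H] [NormedAddCommGroup G] [NormedSpace ℝ G]
  [NormedAddCommGroup K] [NormedSpace ℝ K]

theorem pm_partial_x {F : H × G → K} (hF : ContDiff ℝ 2 F) (a : H) (b : G) (h : H) :
    fderiv ℝ (fun y => F (y, b)) a h = fderiv ℝ F (a, b) (h, 0) := by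
  have h1 : HasFDerivAt F (fderiv ℝ F (a, b)) (a, b) :=
    ((hF.differentiable (by norm_num)) (a, b)).hasFDerivAt
  have h2 := HasFDerivAt.comp (f := fun y : H => (y, b)) a h1 (hasFDerivAt_prodMk_left a b)
  have h3 := h2.fderiv
  change fderiv ℝ (fun y => F (y, b)) a = _ at h3
  rw [h3]; simp

theorem pm_partial_t {F : H × G → K} (hF : ContDiff ℝ 2 F) (a : H) (b : G) (h : G) :
    fderiv ℝ (fun y => F (a, y)) b h = fderiv ℝ F (a, b) (0, h) := by
  have h1 : HasFDerivAt F (fderiv ℝ F (a, b)) (a, b) :=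
    ((hF.differentiable (by norm_num)) (a, b)).hasFDerivAt
  have h2 := HasFDerivAt.comp (f := fun y : G => (a, y)) b h1 (hasFDerivAt_prodMk_right a b)
  have h3 := h2.fderiv
  change fderiv ℝ (fun y => F (a, y)) b = _ at h3
  rw [h3]; simp

theorem pm_fderiv {F : H × G → K} (hF : ContDiff ℝ 2 F) {X : E → H} (hX : ContDiff ℝ 2 X)
    (P : E →L[ℝ] G) (t : E) :
    fderiv ℝ (fun t => F (X t, P t)) t
      = (fderiv ℝ F (X t, P t)).comp ((fderiv ℝ X t).prod P) := by
  have h1 : HasFDerivAt F (fderiv ℝ F (X t, P t)) (X t, P t) :=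
    ((hF.differentiable (by norm_num)) _).hasFDerivAt
  have h2 : HasFDerivAt X (fderiv ℝ X t) t :=
    ((hX.differentiable (by norm_num)) _).hasFDerivAt
  exact (HasFDerivAt.comp (f := fun t => (X t, P t)) t h1 (h2.prodMk P.hasFDerivAt)).fderiv

theorem pm_fderiv2 {F : H × G → K} (hF : ContDiff ℝ 2 F) {X : E → H} (hX : ContDiff ℝ 2 X)
    (P : E →L[ℝ] G) (t u v : E) :
    fderiv ℝ (fderiv ℝ (fun t => F (X t, P t))) t u v
      = fderiv ℝ (fderiv ℝ F) (X t, P t) (fderiv ℝ X t u, P u) (fderiv ℝ X t v, P v)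
        + fderiv ℝ F (X t, P t) (fderiv ℝ (fderiv ℝ X) t u v, 0) := by
  have hX1 : HasFDerivAt X (fderiv ℝ X t) t :=
    ((hX.differentiable (by norm_num)) _).hasFDerivAt
  have hX2 : HasFDerivAt (fderiv ℝ X) (fderiv ℝ (fderiv ℝ X) t) t :=
    (((hX.fderiv_right (m := 1) (by norm_num)).differentiable (by norm_num)) _).hasFDerivAt
  have hF2 : HasFDerivAt (fderiv ℝ F) (fderiv ℝ (fderiv ℝ F) (X t, P t)) (X t, P t) :=
    (((hF.fderiv_right (m := 1) (by norm_num)).differentiable (by norm_num)) _).hasFDerivAt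
  have hc := HasFDerivAt.comp (f := fun t => (X t, P t)) t hF2 (hX1.prodMk P.hasFDerivAt)
  have hv : HasFDerivAt (fun t => (fderiv ℝ X t v, P v))
      (((fderiv ℝ (fderiv ℝ X) t).flip v).prod 0) t := by
    refine HasFDerivAt.prodMk ?_ (hasFDerivAt_const _ _)
    have := hX2.clm_apply (hasFDerivAt_const v t)
    convert this using 1
    ext; simp
  have hfull := hc.clm_apply hv
  have hY : ContDiff ℝ 2 (fun t => F (X t, P t)) := hF.comp (hX.prodMk P.contDiff)
  have hY2 : HasFDerivAt (fderiv ℝ (fun t => F (X t, P t))) (fderiv ℝ (fderiv ℝ (fun t => F (X t, P t))) t) t :=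
    (((hY.fderiv_right (m := 1) (by norm_num)).differentiable (by norm_num)) _).hasFDerivAt
  have hY3 := hY2.clm_apply (hasFDerivAt_const v t)
  have heq : (fun t => fderiv ℝ (fun t => F (X t, P t)) t v)
      = fun t => fderiv ℝ F (X t, P t) (fderiv ℝ X t v, P v) := by
    funext t
    rw [pm_fderiv hF hX]; simp
  rw [heq] at hY3
  have := congrArg (fun L => L u) (hY3.unique hfull)
  simp at this
  rw [this, add_comm]

end Helpers

/-- Pearlmutter's trick: for a feed-forward network with `C²` layers and
scalar output `J(Θ) = x_{n+1}(Θ)` (identification `H_{n+1} = ℝ` given by the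
linear isometry `e`), with tangent pass `ẋ`, backward pass `x̂`, Riesz
representatives `(A_s, B_s)` of `(a,b) ↦ ⟨∇²F_s((ẋ_s,θ̇_s),(a,b)), x̂_{s+1}⟩`,
and the backward recurrence `x̃_{n+1} = 0`, `x̃_s = (∂_xF_s)* x̃_{s+1} + A_s`,
`θ̃_s = (∂_θF_s)* x̃_{s+1} + B_s`, the Hessian-vector product satisfies
`⟨∇²J(Θ)Θ̇, Θ̇'⟩ = ∑_s ⟨θ̃_s, θ̇'_s⟩` for every direction `Θ̇'`. -/
theorem pearlmutter_trick
    {n : ℕ} (H : ℕ → Type*) (G : ℕ → Type*)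
    [∀ s, NormedAddCommGroup (H s)] [∀ s, InnerProductSpace ℝ (H s)]
    [∀ s, CompleteSpace (H s)]
    [∀ s, NormedAddCommGroup (G s)] [∀ s, InnerProductSpace ℝ (G s)]
    [∀ s, CompleteSpace (G s)]
    (e : H (n + 1) ≃ₗᵢ[ℝ] ℝ)
    (F : ∀ s : Fin (n + 1), H s × G s → H (s + 1))
    (hF : ∀ s : Fin (n + 1), ContDiff ℝ 2 (F s))
    (x₀ : H 0)
    (x : PiLp 2 (fun s : Fin (n + 1) => G s) → ∀ s : ℕ, H s)
    (hx0 : ∀ Θ, x Θ 0 = x₀)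
    (hxrec : ∀ Θ, ∀ s : Fin (n + 1), x Θ (s + 1) = F s (x Θ s, Θ s))
    (J : PiLp 2 (fun s : Fin (n + 1) => G s) → ℝ)
    (hJ : ∀ Θ, J Θ = e (x Θ (n + 1)))
    (Θ Θd : PiLp 2 (fun s : Fin (n + 1) => G s))
    (xd : ∀ s : ℕ, H s)
    (hxd0 : xd 0 = 0)
    (hxd : ∀ s : Fin (n + 1),
      xd (s + 1) = fderiv ℝ (fun y => F s (y, Θ s)) (x Θ s) (xd s)
        + fderiv ℝ (fun θ' => F s (x Θ s, θ')) (Θ s) (Θd s))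
    (xhat : ∀ s : ℕ, H s)
    (hxhatTop : xhat (n + 1) = e.symm 1)
    (hxhat : ∀ s : Fin (n + 1),
      xhat s = ContinuousLinearMap.adjoint
        (fderiv ℝ (fun y => F s (y, Θ s)) (x Θ s)) (xhat (s + 1)))
    (A : ∀ s : Fin (n + 1), H s) (B : ∀ s : Fin (n + 1), G s)
    (hAB : ∀ s : Fin (n + 1), ∀ (a : H s) (b : G s),
      ⟪A s, a⟫ + ⟪B s, b⟫
        = ⟪iteratedFDeriv ℝ 2 (F s) (x Θ s, Θ s) ![(xd s, Θd s), (a, b)],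
            xhat (s + 1)⟫)
    (xt : ∀ s : ℕ, H s) (θt : ∀ s : Fin (n + 1), G s)
    (hxtTop : xt (n + 1) = 0)
    (hxt : ∀ s : Fin (n + 1),
      xt s = ContinuousLinearMap.adjoint
        (fderiv ℝ (fun y => F s (y, Θ s)) (x Θ s)) (xt (s + 1)) + A s)
    (hθt : ∀ s : Fin (n + 1),
      θt s = ContinuousLinearMap.adjoint
        (fderiv ℝ (fun θ' => F s (x Θ s, θ')) (Θ s)) (xt (s + 1)) + B s) :
    ∀ Θd' : PiLp 2 (fun s : Fin (n + 1) => G s),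
      iteratedFDeriv ℝ 2 J Θ ![Θd, Θd']
        = ∑ s : Fin (n + 1), ⟪θt s, Θd' s⟫ := by
  intro Θd'
  have key : ∀ s : ℕ, s ≤ n + 1 → ContDiff ℝ 2 (fun T => x T s) ∧
      fderiv ℝ (fun T => x T s) Θ Θd = xd s ∧
      ⟪fderiv ℝ (fderiv ℝ (fun T => x T s)) Θ Θd Θd', xhat s⟫
        + ⟪fderiv ℝ (fun T => x T s) Θ Θd', xt s⟫
        = ∑ i : Fin (n + 1), if (i : ℕ) < s then ⟪θt i, Θd' i⟫ else 0 := by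
    intro s
    induction s with
    | zero =>
      intro _
      have h0 : (fun T => x T 0) = fun _ => x₀ := funext hx0
      rw [h0]
      refine ⟨contDiff_const, ?_, ?_⟩
      · simp [hxd0]
      · have : fderiv ℝ (fun _ : PiLp 2 (fun s : Fin (n + 1) => G s) => x₀) = fun _ => 0 := by
          funext t; simp
        rw [this]; simp
    | succ s ih =>
      intro hs
      obtain ⟨hC, hD, hS⟩ := ih (by omega)
      obtain ⟨i, rfl⟩ : ∃ i : Fin (n + 1), (i : ℕ) = s := ⟨⟨s, by omega⟩, rfl⟩
      let P : PiLp 2 (fun s : Fin (n + 1) => G s) →L[ℝ] G i :=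
        PiLp.proj 2 (fun s : Fin (n + 1) => G s) i
      have hP : ∀ T, P T = T i := fun T => rfl
      have h1 : (fun T => x T (i + 1)) = fun T => F i (x T i, P T) := by
        funext T; exact hxrec T i
      have e1 : ∀ u, fderiv ℝ (fun T => x T (i + 1)) Θ u
          = fderiv ℝ (fun y => F i (y, Θ i)) (x Θ i) (fderiv ℝ (fun T => x T i) Θ u)
            + fderiv ℝ (fun θ' => F i (x Θ i, θ')) (Θ i) (u i) := by
        intro u
        rw [h1, pm_fderiv (hF i) hC, pm_partial_x (hF i), pm_partial_t (hF i), ← map_add]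
        simp [hP]
      have e2 : fderiv ℝ (fderiv ℝ (fun T => x T (i + 1))) Θ Θd Θd'
          = iteratedFDeriv ℝ 2 (F i) (x Θ i, Θ i)
              ![(xd i, Θd i), (fderiv ℝ (fun T => x T i) Θ Θd', Θd' i)]
            + fderiv ℝ (fun y => F i (y, Θ i)) (x Θ i)
              (fderiv ℝ (fderiv ℝ (fun T => x T i)) Θ Θd Θd') := by
        rw [h1, pm_fderiv2 (hF i) hC, pm_partial_x (hF i), iteratedFDeriv_two_apply, hD]
        simp [hP]
      refine ⟨?_, ?_, ?_⟩
      · rw [h1]; exact (hF i).comp (hC.prodMk P.contDiff)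
      · rw [e1, hD, hxd i]
      · have hsum : (∑ j : Fin (n + 1), if (j : ℕ) < (i : ℕ) + 1 then ⟪θt j, Θd' j⟫ else 0)
            = (∑ j : Fin (n + 1), if (j : ℕ) < (i : ℕ) then ⟪θt j, Θd' j⟫ else 0)
              + ⟪θt i, Θd' i⟫ := by
          have : ⟪θt i, Θd' i⟫ = ∑ j : Fin (n + 1), if j = i then ⟪θt j, Θd' j⟫ else 0 := by
            simp
          rw [this, ← Finset.sum_add_distrib]
          refine Finset.sum_congr rfl fun j _ => ?_
          by_cases hji : j = i
          · subst hji; simp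
          · have : (j : ℕ) ≠ i := fun h => hji (Fin.ext h)
            by_cases hlt : (j : ℕ) < i
            · simp [hji, hlt, Nat.lt_succ_of_lt hlt]
            · have : ¬ (j : ℕ) < i + 1 := by omega
              simp only [hji, hlt, this, if_false, add_zero]
        rw [hsum, ← hS, e1, e2, inner_add_left, inner_add_left, ← hAB i, hxhat i, hxt i, hθt i]
        rw [inner_add_right, inner_add_left, ContinuousLinearMap.adjoint_inner_right,
          ContinuousLinearMap.adjoint_inner_right, ContinuousLinearMap.adjoint_inner_left]
        rw [real_inner_comm (A i), real_inner_comm (xt (i + 1))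
          (fderiv ℝ (fun θ' => F i (x Θ i, θ')) (Θ i) (Θd' i))]
        ring
  obtain ⟨hC, -, hS⟩ := key (n + 1) le_rfl
  have hJ' : J = fun T => e (x T (n + 1)) := funext hJ
  have hX2 : HasFDerivAt (fderiv ℝ (fun T => x T (n + 1)))
      (fderiv ℝ (fderiv ℝ (fun T => x T (n + 1))) Θ) Θ :=
    (((hC.fderiv_right (m := 1) (by norm_num)).differentiable (by norm_num)) _).hasFDerivAt
  have hd : fderiv ℝ J = fun T => (e : H (n + 1) →L[ℝ] ℝ).comp
      (fderiv ℝ (fun T => x T (n + 1)) T) := by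
    funext T
    rw [hJ']
    exact ((e : H (n + 1) →L[ℝ] ℝ).hasFDerivAt.comp T
      ((hC.differentiable (by norm_num)) T).hasFDerivAt).fderiv
  have hd2 : fderiv ℝ (fderiv ℝ J) Θ Θd Θd'
      = e (fderiv ℝ (fderiv ℝ (fun T => x T (n + 1))) Θ Θd Θd') := by
    rw [hd, (((hasFDerivAt_const (e : H (n + 1) →L[ℝ] ℝ) Θ)).clm_comp hX2).fderiv]
    simp
  rw [iteratedFDeriv_two_apply]
  simp only [Matrix.cons_val_zero, Matrix.cons_val_one]
  rw [hd2]
  rw [hxtTop, inner_zero_right, add_zero, hxhatTop, ← e.inner_map_map, e.apply_symm_apply] at hS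
  simp only [Fin.is_lt, if_true] at hS
  simpa using hS
end
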